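/- Suppose γ > 0, 1 < q < ∞, α > −1, and 0 < p < ∞. For a holomorphic function f on 𝔹_n, the following are equivalent: (1) f ∈ A^p_α; (2) A_γ^{(q)}(f) ∈ L^p(𝔹_n, dv_α); (3) M_γ^{(q)}(f) ∈ L^p(𝔹_n, dv_α). Moreover, there are constants depending only on γ, q, α, p, n such that ‖f‖_{p,α}, ‖A_γ^{(q)}(f)‖_{L^p(dv_α)}, and ‖M_γ^{(q)}(f)‖_{L^p(dv_α)} are pairwise comparable. -/

import Mathlib

open MeasureTheory Filter Topology
open scoped Classical ENNReal

noncomputable section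

/-- `ℂⁿ` with the Euclidean norm. -/
abbrev En (n : ℕ) := EuclideanSpace ℂ (Fin n)

instance (n : ℕ) : MeasurableSpace (En n) := borel _
instance (n : ℕ) : BorelSpace (En n) := ⟨rfl⟩

/-- The Lebesgue volume measure on `ℂⁿ`. -/
def vol (n : ℕ) : Measure (En n) := Measure.addHaar

/-- The open unit ball `𝔹ₙ` of `ℂⁿ`. -/
def uball (n : ℕ) : Set (En n) := Metric.ball 0 1

/-- The Hermitian pairing `⟨z,w⟩ = ∑ⱼ zⱼ * conj wⱼ`. -/
def herm {n : ℕ} (z w : En n) : ℂ := ∑ j, z j * (starRingEnd ℂ) (w j)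

/-- The orthogonal projection `P_z w` onto the line spanned by `z`. -/
def prj {n : ℕ} (z w : En n) : En n :=
  if z = 0 then 0 else (herm w z / herm z z) • z

/-- The Möbius automorphism `φ_z` of the unit ball. -/
def mobius {n : ℕ} (z w : En n) : En n :=
  ((1 : ℂ) / (1 - herm w z)) •
    (z - prj z w - ((Real.sqrt (1 - ‖z‖ ^ 2) : ℝ) : ℂ) • (w - prj z w))

/-- The Bergman metric `β(z,w)`. -/
def bmet {n : ℕ} (z w : En n) : ℝ :=
  (1 / 2) * Real.log ((1 + ‖mobius z w‖) / (1 - ‖mobius z w‖))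

/-- The Bergman metric ball `D(z,γ)`. -/
def Dball {n : ℕ} (z : En n) (γ : ℝ) : Set (En n) :=
  {w | w ∈ uball n ∧ bmet z w < γ}

/-- The normalizing constant `c_α`. -/
def cnorm (n : ℕ) (α : ℝ) : ℝ :=
  if -1 < α then Real.Gamma (n + α + 1) / (n.factorial * Real.Gamma (α + 1)) else 1

/-- The weighted measure `dv_α = c_α (1-|z|²)^α dv` on the unit ball. -/
def measA (n : ℕ) (α : ℝ) : Measure (En n) :=
  ((vol n).restrict (uball n)).withDensity
    (fun z => ENNReal.ofReal (cnorm n α * (1 - ‖z‖ ^ 2) ^ α))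

/-- The invariant measure `dτ = (1-|z|²)^{-(n+1)} dv` on the unit ball. -/
def measTau (n : ℕ) : Measure (En n) :=
  ((vol n).restrict (uball n)).withDensity
    (fun z => ENNReal.ofReal ((1 - ‖z‖ ^ 2) ^ (-((n : ℝ) + 1))))

/-- The Bergman space (quasi-)norm `‖f‖_{p,α}`, valued in `ℝ≥0∞`. -/
def apnorm (n : ℕ) (p α : ℝ) (f : En n → ℂ) : ℝ≥0∞ :=
  (∫⁻ z, ENNReal.ofReal (‖f z‖ ^ p) ∂measA n α) ^ (1 / p)

/-- The radial derivative `Rf(z) = ∑ z_k ∂f/∂z_k = Df(z)[z]`. -/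
def radD {n : ℕ} (f : En n → ℂ) (z : En n) : ℂ := fderiv ℂ f z z

/-- Iterated radial derivative `R^k f`. -/
def radIter {n : ℕ} : ℕ → (En n → ℂ) → En n → ℂ
  | 0, f => f
  | (k + 1), f => radD (radIter k f)

/-- The pseudo-metric `ϱ` on the unit ball. -/
def rho {n : ℕ} (z w : En n) : ℝ :=
  if z ≠ 0 ∧ w ≠ 0 then
    |‖z‖ - ‖w‖| + ‖1 - herm z w / ((‖z‖ : ℂ) * (‖w‖ : ℂ))‖
  else ‖z‖ + ‖w‖

/-- The area integral `A_γ^{(q)} g(z) = (∫_{D(z,γ)} g(w)^q dτ(w))^{1/q}`, valued in `ℝ≥0∞`. -/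
def areaF {n : ℕ} (γ q : ℝ) (g : En n → ℝ) (z : En n) : ℝ≥0∞ :=
  (∫⁻ w in Dball z γ, ENNReal.ofReal (g w) ^ q ∂measTau n) ^ (1 / q)

/-- The Bergman-ball Hardy–Littlewood type maximal function
`M_γ^{(q)} g(z) = sup { (v_α(D(w,γ))⁻¹ ∫_{D(w,γ)} g^q dv_α)^{1/q} : w ∈ 𝔹ₙ, z ∈ D(w,γ) }`. -/
def maxHL {n : ℕ} (γ q α : ℝ) (g : En n → ℝ) (z : En n) : ℝ≥0∞ :=
  ⨆ w ∈ {w : En n | w ∈ uball n ∧ z ∈ Dball w γ},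
    ((measA n α (Dball w γ))⁻¹ *
      ∫⁻ u in Dball w γ, ENNReal.ofReal (g u) ^ q ∂measA n α) ^ (1 / q)

lemma one_var_aux (p : ℝ) (hp : 0 < p) (g : ℂ → ℂ) (hg : AnalyticOnNhd ℂ g (Metric.closedBall 0 1))
    (h0 : ‖g 0‖ ^ p = Real.exp 1) :
    Real.exp 1 ≤ Real.circleAverage (fun z => ‖g z‖ ^ p) 0 1 := by
  have g0 : g 0 ≠ 0 := by
    intro h
    rw [h, norm_zero, Real.zero_rpow hp.ne'] at h0
    exact (Real.exp_pos 1).ne h0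
  have hg' : AnalyticOnNhd ℂ g (Metric.closedBall 0 |1|) := by simpa using hg
  have hJ := AnalyticOnNhd.circleAverage_log_norm (R := 1) one_ne_zero hg' g0
  have hJ2 : Real.log ‖g 0‖ ≤ Real.circleAverage (Real.log ‖g ·‖) 0 1 := by
    rw [hJ]
    have : 0 ≤ ∑ᶠ u, (MeromorphicOn.divisor g (Metric.closedBall 0 |1|) u : ℝ) *
        Real.log (1 * ‖0 - u‖⁻¹) := by
      refine finsum_nonneg fun u => ?_
      by_cases hu : u ∈ Metric.closedBall (0:ℂ) |1|
      · refine mul_nonneg ?_ ?_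
        · have := MeromorphicOn.AnalyticOnNhd.divisor_nonneg hg' u
          exact_mod_cast this
        · simp at hu
          simp only [zero_sub, norm_neg, one_mul]
          rw [Real.log_inv]
          have := Real.log_nonpos (norm_nonneg u) hu
          linarith
      · rw [Function.locallyFinsuppWithin.apply_eq_zero_of_notMem _ hu]; simp
    linarith
  have hlog : p * Real.log ‖g 0‖ = 1 := by
    rw [← Real.log_rpow (norm_pos_iff.2 g0), h0, Real.log_exp]
  have hsph : AnalyticOnNhd ℂ g (Metric.sphere 0 |1|) := hg'.mono Metric.sphere_subset_closedBall
  have hi1 : CircleIntegrable (fun z => Real.log ‖g z‖) 0 1 :=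
    hsph.meromorphicOn.circleIntegrable_log_norm
  have hi2 : CircleIntegrable (fun z => ‖g z‖ ^ p) 0 1 := by
    apply ContinuousOn.circleIntegrable zero_le_one
    have : ContinuousOn g (Metric.sphere 0 1) := by simpa using hsph.continuousOn
    exact (this.norm).rpow_const (fun x _ => Or.inr hp.le)
  have hm : Real.circleAverage (fun z => (Real.exp 1 * p) * Real.log ‖g z‖) 0 1 ≤
      Real.circleAverage (fun z => ‖g z‖ ^ p) 0 1 := by
    apply Real.circleAverage_mono _ hi2
    · intro x _
      rcases eq_or_ne (g x) 0 with h | h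
      · simp [h, Real.zero_rpow hp.ne']
      · have hpos : 0 < ‖g x‖ ^ p := Real.rpow_pos_of_pos (norm_pos_iff.2 h) p
        have e1 : p * Real.log ‖g x‖ = Real.log (‖g x‖ ^ p) := (Real.log_rpow (norm_pos_iff.2 h) p).symm
        have e2 := Real.add_one_le_exp (Real.log (‖g x‖ ^ p) - 1)
        rw [Real.exp_sub, Real.exp_log hpos] at e2
        rw [mul_assoc, e1]
        have := Real.exp_pos 1
        rw [le_div_iff₀ this] at e2
        nlinarith
    · exact hi1.const_fun_smul (a := Real.exp 1 * p)
  have hc : Real.circleAverage (fun z => (Real.exp 1 * p) * Real.log ‖g z‖) 0 1 =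
     (Real.exp 1 * p) * Real.circleAverage (fun z => Real.log ‖g z‖) 0 1 := by
    exact Real.circleAverage_fun_smul (a := Real.exp 1 * p)
  rw [hc] at hm
  refine le_trans ?_ hm
  have : 0 < Real.exp 1 * p := by positivity
  calc Real.exp 1 = (Real.exp 1 * p) * Real.log ‖g 0‖ := by rw [mul_assoc, hlog, mul_one]
    _ ≤ _ := mul_le_mul_of_nonneg_left hJ2 this.le

lemma one_var (p : ℝ) (hp : 0 < p) (g : ℂ → ℂ) (hg : AnalyticOnNhd ℂ g (Metric.closedBall 0 1)) :
    ‖g 0‖ ^ p ≤ Real.circleAverage (fun z => ‖g z‖ ^ p) 0 1 := by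
  rcases eq_or_ne (g 0) 0 with h | h
  · rw [h, norm_zero, Real.zero_rpow hp.ne']
    exact Real.circleAverage_nonneg_of_nonneg fun x _ => by positivity
  have hpos : 0 < ‖g 0‖ ^ p := Real.rpow_pos_of_pos (norm_pos_iff.2 h) p
  set l : ℝ := Real.exp (1/p) / ‖g 0‖ with hl
  have hl0 : 0 < l := div_pos (Real.exp_pos _) (norm_pos_iff.2 h)
  have hn : ∀ z, ‖(l:ℂ) * g z‖ ^ p = l ^ p * ‖g z‖ ^ p := by
    intro z
    rw [norm_mul, Complex.norm_real, Real.norm_of_nonneg hl0.le, Real.mul_rpow hl0.le (norm_nonneg _)]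
  have hlp : l ^ p * ‖g 0‖ ^ p = Real.exp 1 := by
    rw [hl, Real.div_rpow (Real.exp_pos _).le (norm_nonneg _), div_mul_cancel₀ _ hpos.ne',
      ← Real.exp_mul, one_div, inv_mul_cancel₀ hp.ne']
  have := one_var_aux p hp (fun z => (l:ℂ) * g z) (fun z hz => analyticAt_const.mul (hg z hz))
    (by rw [hn, hlp])
  simp only [hn] at this
  have hc : Real.circleAverage (fun z => l ^ p * ‖g z‖ ^ p) 0 1 =
     l ^ p * Real.circleAverage (fun z => ‖g z‖ ^ p) 0 1 := by
    exact Real.circleAverage_fun_smul (a := l ^ p)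
  rw [hc, ← hlp] at this
  exact le_of_mul_le_mul_left this (Real.rpow_pos_of_pos hl0 p)

lemma one_var_lint (p : ℝ) (hp : 0 < p) (g : ℂ → ℂ)
    (hg : AnalyticOnNhd ℂ g (Metric.closedBall 0 1)) :
    ENNReal.ofReal (2 * Real.pi) * ENNReal.ofReal (‖g 0‖ ^ p) ≤
      ∫⁻ θ in Set.Ioc 0 (2 * Real.pi), ENNReal.ofReal (‖g (circleMap 0 1 θ)‖ ^ p) := by
  have h := one_var p hp g hg
  rw [Real.circleAverage_def, smul_eq_mul, inv_mul_eq_div, le_div_iff₀ (by positivity),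
    intervalIntegral.integral_of_le (by positivity)] at h
  rw [← ENNReal.ofReal_mul (by positivity), mul_comm (2 * Real.pi), 
    ← ofReal_integral_eq_lintegral_ofReal]
  · exact ENNReal.ofReal_le_ofReal h
  · have hi2 : CircleIntegrable (fun z => ‖g z‖ ^ p) 0 1 := by
      apply ContinuousOn.circleIntegrable zero_le_one
      have : ContinuousOn g (Metric.sphere 0 1) := 
        (hg.mono Metric.sphere_subset_closedBall).continuousOn
      exact (this.norm).rpow_const (fun x _ => Or.inr hp.le)
    have : IntervalIntegrable (fun θ => ‖g (circleMap 0 1 θ)‖ ^ p) volume 0 (2 * Real.pi) := hi2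
    exact (intervalIntegrable_iff_integrableOn_Ioc_of_le (by positivity)).1 this
  · exact Eventually.of_forall fun x => by positivity

instance vol_haar (n : ℕ) : (vol n).IsAddHaarMeasure := by
  unfold vol; infer_instance

lemma det_real (n : ℕ) (T : En n →L[ℂ] En n) :
    |(T.restrictScalars ℝ).det| = ‖T.toLinearMap.det‖ ^ 2 := by
  have : (T.restrictScalars ℝ).det = ((T.toLinearMap).restrictScalars ℝ).det := rfl
  rw [this, LinearMap.det_restrictScalars, Algebra.norm_complex_apply, Complex.normSq_eq_norm_sq,
    abs_of_nonneg (by positivity)]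

lemma cov (n : ℕ) (T : En n →L[ℂ] En n) (hT : Function.Injective T) (z : En n) (S : Set (En n))
    (hS : MeasurableSet S) (F : En n → ℝ≥0∞) :
    ∫⁻ x in (fun u => z + T u) '' S, F x ∂vol n =
      ENNReal.ofReal (‖T.toLinearMap.det‖ ^ 2) * ∫⁻ u in S, F (z + T u) ∂vol n := by
  rw [lintegral_image_eq_lintegral_abs_det_fderiv_mul (vol n) hS (f' := fun _ => T.restrictScalars ℝ)]
  · rw [det_real, lintegral_const_mul' _ _ ENNReal.ofReal_ne_top]
  · intro x _
    exact (((T.restrictScalars ℝ).hasFDerivAt).const_add z).hasFDerivWithinAt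
  · intro a _ b _ h
    exact hT (by simpa using h)

lemma rot (n : ℕ) (ρ : ℝ) (c : ℂ) (hc : ‖c‖ = 1) (F : En n → ℝ≥0∞) :
    ∫⁻ u in Metric.ball 0 ρ, F (c • u) ∂vol n = ∫⁻ u in Metric.ball 0 ρ, F u ∂vol n := by
  have hc0 : c ≠ 0 := by intro h; simp [h] at hc
  have h := cov n (c • ContinuousLinearMap.id ℂ (En n)) (fun a b h => by
    simpa [hc0] using h) 0 (Metric.ball 0 ρ) measurableSet_ball F
  have hd : ‖((c • ContinuousLinearMap.id ℂ (En n)).toLinearMap).det‖ = 1 := by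
    rw [ContinuousLinearMap.toLinearMap_smul, LinearMap.det_smul]
    simp [hc]
  rw [hd] at h
  have hi : (fun u : En n => (0 : En n) + (c • ContinuousLinearMap.id ℂ (En n)) u) '' Metric.ball 0 ρ
      = Metric.ball 0 ρ := by
    ext x
    constructor
    · rintro ⟨u, hu, rfl⟩
      simpa [norm_smul, hc] using hu
    · intro hx
      refine ⟨c⁻¹ • x, ?_, ?_⟩
      · simpa [norm_smul, hc] using hx
      · simp [smul_smul, hc0]
  rw [hi] at h
  simpa using h.symm

lemma meas_ind (n : ℕ) (p : ℝ) (hp : 0 < p) (B : Set (En n)) (hB : IsOpen B) (h : En n → ℂ)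
    (hh : DifferentiableOn ℂ h B) :
    Measurable (B.indicator (fun u => ENNReal.ofReal (‖h u‖ ^ p))) := by
  have hBm : MeasurableSet B := hB.measurableSet
  have hco : ContinuousOn (fun u => ENNReal.ofReal (‖h u‖ ^ p)) B :=
    ENNReal.continuous_ofReal.comp_continuousOn
      ((hh.continuousOn.norm).rpow_const (fun x _ => Or.inr hp.le))
  have := (measurable_of_isOpen (f := B.domRestrict (fun u => ENNReal.ofReal (‖h u‖ ^ p)))
    (fun s hs => ((continuousOn_iff_continuous_domRestrict.1 hco).isOpen_preimage s hs).measurableSet))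
  refine measurable_of_restrict_of_restrict_compl hBm ?_ ?_
  · convert this using 1
    ext x; simp
  · have : Bᶜ.domRestrict (B.indicator (fun u => ENNReal.ofReal (‖h u‖ ^ p))) = fun _ => 0 := by
      ext x
      have hx : (x : En n) ∉ B := x.2
      simp [Set.domRestrict_apply, Set.indicator_of_notMem hx]
    rw [this]; exact measurable_const

lemma submean_ball (n : ℕ) (p ρ : ℝ) (hp : 0 < p) (h : En n → ℂ)
    (hh : DifferentiableOn ℂ h (Metric.ball 0 ρ)) :
    vol n (Metric.ball 0 ρ) * ENNReal.ofReal (‖h 0‖ ^ p) ≤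
      ∫⁻ u in Metric.ball 0 ρ, ENNReal.ofReal (‖h u‖ ^ p) ∂vol n := by
  set B : Set (En n) := Metric.ball 0 ρ with hB
  have hBm : MeasurableSet B := measurableSet_ball
  set G : En n → ℝ≥0∞ := B.indicator (fun u => ENNReal.ofReal (‖h u‖ ^ p)) with hG
  have hGm : Measurable G := by
    exact meas_ind n p hp B Metric.isOpen_ball h hh
  have key : ∀ u ∈ B, ENNReal.ofReal (2 * Real.pi) * ENNReal.ofReal (‖h 0‖ ^ p) ≤
      ∫⁻ θ in Set.Ioc 0 (2 * Real.pi), G ((circleMap 0 1 θ : ℂ) • u) := by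
    intro u hu
    have hmem : ∀ ζ : ℂ, ‖ζ‖ ≤ 1 → ζ • u ∈ B := by
      intro ζ hζ
      simp only [hB, mem_ball_zero_iff, norm_smul] at hu ⊢
      nlinarith [norm_nonneg u, norm_nonneg ζ]
    have han : AnalyticOnNhd ℂ (fun ζ : ℂ => h (ζ • u)) (Metric.closedBall 0 1) := by
      have hopen : IsOpen {ζ : ℂ | ζ • u ∈ B} :=
        Metric.isOpen_ball.preimage (by fun_prop : Continuous fun ζ : ℂ => ζ • u)
      have hd : DifferentiableOn ℂ (fun ζ : ℂ => h (ζ • u)) {ζ : ℂ | ζ • u ∈ B} :=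
        hh.comp (by fun_prop) (fun ζ hζ => hζ)
      exact (hd.analyticOnNhd hopen).mono (fun ζ hζ => hmem ζ (by simpa using hζ))
    have := one_var_lint p hp _ han
    simp only [zero_smul] at this
    refine this.trans_eq ?_
    congr 1
    ext θ
    rw [hG, Set.indicator_of_mem (hmem _ (by simp))]
  have h2 : ∫⁻ u in B, ENNReal.ofReal (2 * Real.pi) * ENNReal.ofReal (‖h 0‖ ^ p) ∂vol n ≤
      ∫⁻ u in B, (∫⁻ θ in Set.Ioc 0 (2 * Real.pi), G ((circleMap 0 1 θ : ℂ) • u)) ∂vol n :=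
    setLIntegral_mono' hBm key
  rw [lintegral_lintegral_swap] at h2
  swap
  · refine Measurable.aemeasurable (hGm.comp ?_)
    apply Continuous.measurable
    have : Continuous (circleMap 0 1) := continuous_circleMap 0 1
    fun_prop
  have h3 : ∀ θ : ℝ, ∫⁻ u in B, G ((circleMap 0 1 θ : ℂ) • u) ∂vol n = ∫⁻ u in B, G u ∂vol n :=
    fun θ => rot n ρ _ (by simp) G
  simp only [h3, lintegral_const, Measure.restrict_apply MeasurableSet.univ, Set.univ_inter,
    Real.volume_Ioc, sub_zero] at h2
  have h4 : ∫⁻ u in B, G u ∂vol n = ∫⁻ u in B, ENNReal.ofReal (‖h u‖ ^ p) ∂vol n := by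
    apply setLIntegral_congr_fun hBm
    intro u hu
    simp [hG, hu]
  rw [← h4]
  have hpi : ENNReal.ofReal (2 * Real.pi) ≠ 0 := by
    simp [Real.pi_pos]
  rw [mul_comm (∫⁻ u in B, G u ∂vol n), mul_assoc, mul_comm (ENNReal.ofReal (‖h 0‖ ^ p))] at h2
  exact (ENNReal.mul_le_mul_iff_right hpi ENNReal.ofReal_ne_top).1 h2

def Rd {n : ℕ} (δ : ℝ) (z w : En n) : Prop :=
  δ * ‖1 - herm w z‖ ^ 2 < (1 - ‖z‖ ^ 2) * (1 - ‖w‖ ^ 2)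

def Dd {n : ℕ} (δ : ℝ) (z : En n) : Set (En n) := {w | w ∈ uball n ∧ Rd δ z w}

lemma herm_eq {n : ℕ} (z w : En n) : herm z w = inner ℂ w z := by
  simp [herm, PiLp.inner_apply]

lemma herm_self {n : ℕ} (z : En n) : herm z z = ((‖z‖ ^ 2 : ℝ) : ℂ) := by
  rw [herm_eq, inner_self_eq_norm_sq_to_K]; norm_cast

lemma herm_conj {n : ℕ} (z w : En n) : (starRingEnd ℂ) (herm z w) = herm w z := by
  rw [herm_eq, herm_eq, inner_conj_symm]

lemma herm_le {n : ℕ} (z w : En n) : ‖herm z w‖ ≤ ‖z‖ * ‖w‖ := by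
  rw [herm_eq, mul_comm]; exact norm_inner_le_norm w z

lemma herm_symm {n : ℕ} (z w : En n) : ‖1 - herm z w‖ = ‖1 - herm w z‖ := by
  rw [← herm_conj w z, ← Complex.norm_conj (1 - herm w z)]; simp

lemma mem_uball {n : ℕ} (z : En n) : z ∈ uball n ↔ ‖z‖ < 1 := by
  simp [uball]

lemma t_pos {n : ℕ} {z : En n} (hz : z ∈ uball n) : 0 < 1 - ‖z‖ ^ 2 := by
  rw [mem_uball] at hz; nlinarith [norm_nonneg z]

lemma t_le {n : ℕ} (z : En n) : 1 - ‖z‖ ^ 2 ≤ 1 := by nlinarith [norm_nonneg z]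

lemma herm_low {n : ℕ} {z w : En n} (hz : z ∈ uball n) (hw : w ∈ uball n) :
    1 - ‖z‖ ^ 2 ≤ 2 * ‖1 - herm w z‖ := by
  rw [mem_uball] at hz hw
  have h1 : 1 - ‖herm w z‖ ≤ ‖1 - herm w z‖ := by
    have := norm_sub_norm_le (1:ℂ) (herm w z)
    simpa using this
  have h2 := herm_le w z
  nlinarith [norm_nonneg z, norm_nonneg w]

lemma Rd_symm {n : ℕ} {δ : ℝ} {z w : En n} (h : Rd δ z w) : Rd δ w z := by
  unfold Rd at *; rw [herm_symm]; linarith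

lemma Rd_comp {n : ℕ} {δ : ℝ} (hδ : 0 < δ) {z w : En n} (hz : z ∈ uball n) (hw : w ∈ uball n)
    (h : Rd δ z w) : δ / 4 * (1 - ‖z‖ ^ 2) ≤ 1 - ‖w‖ ^ 2 := by
  have h1 := herm_low hz hw
  have h2 := t_pos hz
  unfold Rd at h
  have h3 : (1 - ‖z‖ ^ 2) ^ 2 ≤ 4 * ‖1 - herm w z‖ ^ 2 := by nlinarith
  have h4 : (1 - ‖z‖ ^ 2) * (δ / 4 * (1 - ‖z‖ ^ 2)) ≤ (1 - ‖z‖ ^ 2) * (1 - ‖w‖ ^ 2) := by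
    nlinarith
  exact le_of_mul_le_mul_left h4 h2

lemma Rd_bound {n : ℕ} {δ : ℝ} (hδ : 0 < δ) {z w : En n} (hz : z ∈ uball n) (hw : w ∈ uball n)
    (h : Rd δ z w) : ‖1 - herm w z‖ ≤ 2 / δ * (1 - ‖z‖ ^ 2) := by
  have h1 := Rd_comp hδ hw hz (Rd_symm h)
  have h2 := t_pos hz
  unfold Rd at h
  have h3 : (δ * ‖1 - herm w z‖) ^ 2 ≤ (2 * (1 - ‖z‖ ^ 2)) ^ 2 := by nlinarith
  have h4 := abs_le_of_sq_le_sq h3 (by positivity)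
  rw [div_mul_eq_mul_div, le_div_iff₀ hδ]
  linarith [le_of_abs_le h4]

lemma norm_sub_herm {n : ℕ} {z w : En n} (hz : z ∈ uball n) (hw : w ∈ uball n) :
    ‖w - z‖ ^ 2 ≤ 2 * ‖1 - herm w z‖ := by
  have h1 := @norm_sub_sq ℂ _ _ _ _ w z
  have h2 : (1 - herm w z).re ≤ ‖1 - herm w z‖ := Complex.re_le_norm _
  have h3 : RCLike.re (inner ℂ w z) = (herm w z).re := by
    rw [← herm_eq, ← herm_conj]; simp
  rw [h3] at h1
  simp at h2
  have := t_pos hz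
  have := t_pos hw
  linarith

lemma quasi {n : ℕ} {z w u : En n} (hz : z ∈ uball n) (hw : w ∈ uball n) (hu : u ∈ uball n) :
    ‖1 - herm z u‖ ≤ ‖1 - herm z w‖ + ‖1 - herm w u‖ + (1 - ‖w‖ ^ 2)
      + (‖1 - herm z w‖ + ‖1 - herm w u‖) := by
  have e : 1 - herm z u = (1 - herm z w) + (1 - herm w u) - ((1 - ‖w‖ ^ 2 : ℝ) : ℂ)
      + herm (z - w) (w - u) := by
    have := herm_self w
    simp only [herm_eq, inner_sub_left, inner_sub_right] at *
    rw [this]; push_cast; ring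
  have h1 := norm_sub_herm hw hz
  have h2 := norm_sub_herm hu hw
  have h3 := herm_le (z - w) (w - u)
  have h4 : ‖((1 - ‖w‖ ^ 2 : ℝ) : ℂ)‖ = 1 - ‖w‖ ^ 2 := by
    rw [Complex.norm_real, Real.norm_of_nonneg (t_pos hw).le]
  rw [e]
  have h5 := norm_add_le ((1 - herm z w) + (1 - herm w u) - ((1 - ‖w‖ ^ 2 : ℝ) : ℂ))
    (herm (z - w) (w - u))
  have h6 := norm_sub_le ((1 - herm z w) + (1 - herm w u)) ((1 - ‖w‖ ^ 2 : ℝ) : ℂ)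
  have h7 := norm_add_le (1 - herm z w) (1 - herm w u)
  rw [h4] at h6
  nlinarith [sq_nonneg (‖z - w‖ - ‖w - u‖)]

lemma Rd_trans {n : ℕ} {δ : ℝ} (hδ : 0 < δ) (hδ1 : δ ≤ 1) {z w u : En n} (hz : z ∈ uball n)
    (hw : w ∈ uball n) (hu : u ∈ uball n) (h1 : Rd δ z w) (h2 : Rd δ w u) :
    Rd (δ ^ 4 / 1400) z u := by
  have a1 := Rd_comp hδ hw hz (Rd_symm h1)
  have a2 := Rd_comp hδ hw hu h2
  have b1 := Rd_bound hδ hw hz (Rd_symm h1)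
  have b2 := Rd_bound hδ hw hu h2
  rw [herm_symm] at b2
  have q := quasi hz hw hu
  have tw := t_pos hw
  set T := 1 - ‖w‖ ^ 2 with hT
  have c1 : ‖1 - herm z u‖ ≤ 9 / δ * T := by
    have : T ≤ 1 / δ * T := by
      rw [div_mul_eq_mul_div, le_div_iff₀ hδ]; nlinarith
    have e : 9 / δ * T = 4 * (2 / δ * T) + 1 / δ * T := by ring
    linarith
  rw [div_mul_eq_mul_div, le_div_iff₀ hδ] at c1
  have c2 : (‖1 - herm z u‖ * δ) ^ 2 ≤ (9 * T) ^ 2 := by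
    apply pow_le_pow_left₀ (by positivity) c1
  have c3 : (δ / 4 * T) * (δ / 4 * T) ≤ (1 - ‖z‖ ^ 2) * (1 - ‖u‖ ^ 2) := by
    apply mul_le_mul a1 a2 (by positivity) (t_pos hz).le
  unfold Rd
  rw [herm_symm u z]
  refine lt_of_lt_of_le ?_ c3
  calc δ ^ 4 / 1400 * ‖1 - herm z u‖ ^ 2 = δ ^ 2 / 1400 * (‖1 - herm z u‖ * δ) ^ 2 := by ring
    _ ≤ δ ^ 2 / 1400 * (9 * T) ^ 2 := by gcongr
    _ < (δ / 4 * T) * (δ / 4 * T) := by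
      have : 0 < δ ^ 2 * T ^ 2 := by positivity
      nlinarith

lemma Rd_mono {n : ℕ} {δ δ' : ℝ} (h : δ' ≤ δ) {z w : En n} (h1 : Rd δ z w) : Rd δ' z w := by
  unfold Rd at *
  refine lt_of_le_of_lt ?_ h1
  gcongr

lemma Rd_self {n : ℕ} {δ : ℝ} (hδ1 : δ < 1) {z : En n} (hz : z ∈ uball n) : Rd δ z z := by
  unfold Rd
  have e : ‖1 - herm z z‖ = 1 - ‖z‖ ^ 2 := by
    rw [herm_self]
    have : (1 : ℂ) - ((‖z‖ ^ 2 : ℝ) : ℂ) = ((1 - ‖z‖ ^ 2 : ℝ) : ℂ) := by push_cast; ring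
    rw [this, Complex.norm_real, Real.norm_of_nonneg (t_pos hz).le]
  rw [e]
  have := t_pos hz
  nlinarith [mul_pos this this]

lemma mobius_norm {n : ℕ} {z w : En n} (hz : z ∈ uball n) (hw : w ∈ uball n) :
    ‖mobius z w‖ ^ 2 * ‖1 - herm w z‖ ^ 2 =
      ‖1 - herm w z‖ ^ 2 - (1 - ‖z‖ ^ 2) * (1 - ‖w‖ ^ 2) := by
  have hne : 0 < ‖1 - herm w z‖ := by
    have := herm_low hz hw
    have := t_pos hz
    linarith
  unfold mobius
  rw [norm_smul, norm_div, norm_one, mul_pow, div_pow, one_pow, mul_right_comm, 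
    div_mul_cancel₀ _ (pow_pos hne 2).ne', one_mul]
  have hsq : ‖1 - herm w z‖ ^ 2 = 1 - 2 * (herm w z).re + ‖herm w z‖ ^ 2 := by
    rw [← Complex.normSq_eq_norm_sq, ← Complex.normSq_eq_norm_sq, Complex.normSq_apply,
      Complex.normSq_apply]
    simp; ring
  by_cases h0 : z = 0
  · simp [h0, prj, herm_eq]
  have hz0 : (‖z‖ ^ 2 : ℝ) ≠ 0 := by simpa using h0
  set s := Real.sqrt (1 - ‖z‖ ^ 2) with hs
  have hs2 : s ^ 2 = 1 - ‖z‖ ^ 2 := Real.sq_sqrt (t_pos hz).le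
  set N := ‖z‖ ^ 2 with hN
  set a := herm w z with ha
  set x : ℂ := 1 + ((s - 1 : ℝ) : ℂ) * a / (N : ℂ) with hx
  have hv : z - prj z w - (s : ℂ) • (w - prj z w) = x • z - (s : ℂ) • w := by
    simp only [prj, h0, if_false, herm_self, ← ha, ← hN, hx]
    push_cast
    module
  rw [hv, @norm_sub_sq ℂ, inner_smul_left, inner_smul_right, norm_smul, norm_smul, hsq,
    ← herm_eq, ← ha]
  have hxr : x.re = 1 + (s - 1) * a.re / N := by
    rw [hx]; rw [mul_div_assoc, Complex.add_re, Complex.re_ofReal_mul, Complex.div_ofReal_re]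
    simp; ring
  have hxi : x.im = (s - 1) * a.im / N := by
    rw [hx]; rw [mul_div_assoc, Complex.add_im, Complex.im_ofReal_mul, Complex.div_ofReal_im]
    simp; ring
  have hre : RCLike.re ((starRingEnd ℂ) x * ((s : ℂ) * a)) = s * (x.re * a.re + x.im * a.im) := by
    simp; ring
  rw [hre, mul_pow, mul_pow, ← hN, ← Complex.normSq_eq_norm_sq x, ← Complex.normSq_eq_norm_sq a,
    Complex.normSq_apply, Complex.normSq_apply, hxr, hxi, Complex.norm_real, Real.norm_eq_abs,
    sq_abs]
  have hN' : N = 1 - s ^ 2 := by linarith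
  have hN0 : (1 - s ^ 2) ≠ 0 := by rw [← hN']; exact hz0
  rw [hN']
  field_simp
  ring

lemma Dball_eq {n : ℕ} {γ : ℝ} (hγ : 0 < γ) : ∃ δ : ℝ, 0 < δ ∧ δ < 1 ∧ ∀ z : En n, z ∈ uball n →
    Dball z γ = Dd δ z := by
  set E := Real.exp (2 * γ) with hE
  have hE1 : 1 < E := by rw [hE]; exact Real.one_lt_exp_iff.2 (by linarith)
  set r := (E - 1) / (E + 1) with hr
  have hr0 : 0 < r := div_pos (by linarith) (by linarith)
  have hr1 : r < 1 := by rw [hr, div_lt_one (by linarith)]; linarith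
  refine ⟨1 - r ^ 2, by nlinarith, by nlinarith, fun z hz => ?_⟩
  ext w
  simp only [Dball, Dd, Set.mem_ofPred_eq]
  refine and_congr_right fun hw => ?_
  have hm := mobius_norm hz hw
  have hne : 0 < ‖1 - herm w z‖ := by
    have := herm_low hz hw
    have := t_pos hz
    linarith
  set x := ‖mobius z w‖ with hx
  have hx0 : 0 ≤ x := norm_nonneg _
  have hne2 : 0 < ‖1 - herm w z‖ ^ 2 := by positivity
  have hx1 : x < 1 := by
    have := mul_pos (t_pos hz) (t_pos hw)
    have h2 : x ^ 2 * ‖1 - herm w z‖ ^ 2 < 1 * ‖1 - herm w z‖ ^ 2 := by linarith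
    have := lt_of_mul_lt_mul_right h2 hne2.le
    nlinarith
  unfold bmet Rd
  rw [← hx]
  have s1 : 1 / 2 * Real.log ((1 + x) / (1 - x)) < γ ↔ x < r := by
    rw [show (1 / 2 * Real.log ((1 + x) / (1 - x)) < γ) ↔ Real.log ((1 + x) / (1 - x)) < 2 * γ by
      constructor <;> intro h <;> linarith]
    rw [Real.log_lt_iff_lt_exp (div_pos (by linarith) (by linarith)), ← hE,
      div_lt_iff₀ (by linarith), hr, lt_div_iff₀ (by linarith)]
    constructor <;> intro h <;> linarith
  rw [s1]
  have s2 : x < r ↔ x ^ 2 < r ^ 2 := (pow_lt_pow_iff_left₀ hx0 hr0.le two_ne_zero).symm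
  rw [s2]
  have s3 : x ^ 2 < r ^ 2 ↔ x ^ 2 * ‖1 - herm w z‖ ^ 2 < r ^ 2 * ‖1 - herm w z‖ ^ 2 :=
    (mul_lt_mul_iff_left₀ hne2).symm
  rw [s3, hm]
  constructor <;> intro h <;> linarith

lemma exists_unit {n : ℕ} (hn : 1 ≤ n) (z : En n) : ∃ e : En n, ‖e‖ = 1 ∧ z = (‖z‖ : ℂ) • e := by
  by_cases h : z = 0
  · refine ⟨EuclideanSpace.single ⟨0, hn⟩ 1, by simp, by simp [h]⟩
  · have hz : (‖z‖ : ℂ) ≠ 0 := by simpa using h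
    refine ⟨(‖z‖ : ℂ)⁻¹ • z, ?_, ?_⟩
    · rw [norm_smul]; simp [h]
    · rw [smul_smul, mul_inv_cancel₀ hz, one_smul]

lemma exists_T {n : ℕ} (hn : 1 ≤ n) (z : En n) (hz : z ∈ uball n) :
    ∃ T : En n →L[ℂ] En n, Function.Bijective T ∧
      ‖T.toLinearMap.det‖ ^ 2 = (1 - ‖z‖ ^ 2) ^ (n + 1) ∧
      (∀ u, ‖herm (T u) z‖ ≤ (1 - ‖z‖ ^ 2) * ‖u‖) ∧
      (∀ u, ‖T u‖ ^ 2 ≤ (1 - ‖z‖ ^ 2) * ‖u‖ ^ 2) ∧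
      (∀ u, ‖u‖ ^ 2 * (1 - ‖z‖ ^ 2) ^ 2 ≤
        ‖herm (T u) z‖ ^ 2 + 2 * (1 - ‖z‖ ^ 2) * ‖T u‖ ^ 2) := by
  obtain ⟨e, he, hze⟩ := exists_unit hn z
  have ht := t_pos hz
  set t := 1 - ‖z‖ ^ 2 with htd
  set s := Real.sqrt t with hs
  have hs2 : s ^ 2 = t := Real.sq_sqrt ht.le
  have hs0 : 0 < s := Real.sqrt_pos.2 ht
  let f : Module.Dual ℂ (En n) := ((s - 1 : ℝ) : ℂ) • (innerSL ℂ e).toLinearMap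
  let T0 : En n →ₗ[ℂ] En n := (s : ℂ) • LinearMap.transvection f e
  have hdet : T0.det = (s : ℂ) ^ (n + 1) := by
    have : f e = ((s - 1 : ℝ) : ℂ) := by
      simp [f, inner_self_eq_norm_sq_to_K, he]
    rw [LinearMap.det_smul, LinearMap.transvection.det, this]
    simp
    ring
  let T : En n →L[ℂ] En n := LinearMap.toContinuousLinearMap T0
  have hTT : T.toLinearMap = T0 := by ext; rfl
  have hTu : ∀ u, T u = (s : ℂ) • (u + (((s - 1 : ℝ) : ℂ) * inner ℂ e u) • e) := by
    intro u
    simp [T, T0, LinearMap.transvection.apply, f]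
  have hin : ∀ u, inner ℂ e (T u) = (t : ℂ) * inner ℂ e u := by
    intro u
    rw [hTu, inner_smul_right, inner_add_right, inner_smul_right, inner_self_eq_norm_sq_to_K, he,
      ← hs2]
    push_cast; ring
  have hnorm : ∀ u, ‖T u‖ ^ 2 = t * ‖u‖ ^ 2 - t * (1 - t) * ‖inner ℂ e u‖ ^ 2 := by
    intro u
    rw [hTu, norm_smul, mul_pow, @norm_add_sq ℂ, norm_smul, he, inner_smul_right, norm_mul,
      Complex.norm_real, Complex.norm_real, Real.norm_eq_abs, Real.norm_eq_abs, sq_abs, mul_one, mul_pow, sq_abs]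
    have : RCLike.re (((s - 1 : ℝ) : ℂ) * inner ℂ e u * inner ℂ u e) =
        (s - 1) * ‖inner ℂ e u‖ ^ 2 := by
      rw [mul_assoc, ← inner_conj_symm u e, Complex.mul_conj, Complex.normSq_eq_norm_sq,
        ← Complex.ofReal_mul]
      exact Complex.ofReal_re _
    rw [this, ← hs2]; ring
  have hcs : ∀ u, ‖inner ℂ e u‖ ≤ ‖u‖ := by
    intro u
    simpa [he] using norm_inner_le_norm (𝕜 := ℂ) e u
  have hherm : ∀ u, ‖herm (T u) z‖ = ‖z‖ * (t * ‖inner ℂ e u‖) := by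
    intro u
    rw [herm_eq]
    conv_lhs => rw [hze]
    rw [inner_smul_left, hin, norm_mul, norm_mul, Complex.norm_real t, Real.norm_of_nonneg ht.le]
    simp
  have ht1 : t ≤ 1 := t_le z
  refine ⟨T, ?_, ?_, ?_, ?_, ?_⟩
  · have hu : IsUnit T0.det := by
      rw [hdet]; exact (pow_ne_zero _ (by exact_mod_cast hs0.ne')).isUnit
    exact (Module.End.isUnit_iff T0).1 ((LinearMap.isUnit_iff_isUnit_det T0).2 hu)
  · rw [hTT, hdet, norm_pow, Complex.norm_real, Real.norm_of_nonneg hs0.le, ← hs2]; ring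
  · intro u
    rw [hherm]
    have h1 := hcs u
    have h2 : ‖z‖ ≤ 1 := ((mem_uball z).1 hz).le
    have h3 : t * ‖inner ℂ e u‖ ≤ t * ‖u‖ := by gcongr
    have h4 : 0 ≤ t * ‖inner ℂ e u‖ := by positivity
    nlinarith
  · intro u
    rw [hnorm]
    have : 0 ≤ t * (1 - t) * ‖inner ℂ e u‖ ^ 2 := by
      have : 0 ≤ 1 - t := by linarith
      positivity
    linarith
  · intro u
    rw [hherm, hnorm]
    have h1 : ‖inner ℂ e u‖ ^ 2 ≤ ‖u‖ ^ 2 := pow_le_pow_left₀ (norm_nonneg _) (hcs u) 2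
    have h2 : ‖z‖ ^ 2 = 1 - t := by rw [htd]; ring
    rw [mul_pow, h2]
    have h3 : (t ^ 2 * (1 - t)) * ‖inner ℂ e u‖ ^ 2 ≤ (t ^ 2 * 1) * ‖u‖ ^ 2 := by
      apply mul_le_mul _ h1 (by positivity) (by positivity)
      gcongr; linarith
    nlinarith

lemma incl1 {n : ℕ} {δ c : ℝ} (hδ : 0 < δ) (hc : 0 < c) (hc1 : c ≤ 1)
    (hcd : δ * (1 + c) ^ 2 < 1 - 3 * c) {z v : En n} (hz : z ∈ uball n)
    (h1 : ‖herm v z‖ ≤ (1 - ‖z‖ ^ 2) * c) (h2 : ‖v‖ ^ 2 ≤ (1 - ‖z‖ ^ 2) * c ^ 2) :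
    z + v ∈ Dd δ z := by
  have ht := t_pos hz
  have e1 := @norm_add_sq ℂ _ _ _ _ z v
  rw [← herm_eq] at e1
  have e2 : RCLike.re (herm v z) ≤ ‖herm v z‖ := Complex.re_le_norm _
  have e3 : herm (z + v) z = ((‖z‖ ^ 2 : ℝ) : ℂ) + herm v z := by
    rw [← herm_self]; simp only [herm_eq, inner_add_right]
  have e4 : ‖1 - herm (z + v) z‖ ≤ (1 - ‖z‖ ^ 2) * (1 + c) := by
    rw [e3]
    have : (1 : ℂ) - (((‖z‖ ^ 2 : ℝ) : ℂ) + herm v z) = ((1 - ‖z‖ ^ 2 : ℝ) : ℂ) - herm v z := by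
      push_cast; ring
    rw [this]
    have := norm_sub_le ((1 - ‖z‖ ^ 2 : ℝ) : ℂ) (herm v z)
    rw [Complex.norm_real, Real.norm_of_nonneg ht.le] at this
    linarith
  set t := 1 - ‖z‖ ^ 2 with htd
  have e5 : t * (1 - 3 * c) ≤ 1 - ‖z + v‖ ^ 2 := by
    have : t * c ^ 2 ≤ t * c := by gcongr; nlinarith
    rw [e1]
    nlinarith
  have hpos : 0 < 1 - 3 * c := lt_of_le_of_lt (by positivity) hcd
  have e6 : 0 < 1 - ‖z + v‖ ^ 2 := lt_of_lt_of_le (by positivity) e5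
  refine ⟨?_, ?_⟩
  · rw [mem_uball]; nlinarith [norm_nonneg (z + v)]
  · unfold Rd
    have e7 : ‖1 - herm (z + v) z‖ ^ 2 ≤ (t * (1 + c)) ^ 2 := pow_le_pow_left₀ (norm_nonneg _) e4 2
    calc δ * ‖1 - herm (z + v) z‖ ^ 2 ≤ δ * (t * (1 + c)) ^ 2 := by gcongr
      _ = t ^ 2 * (δ * (1 + c) ^ 2) := by ring
      _ < t ^ 2 * (1 - 3 * c) := by gcongr
      _ = t * (t * (1 - 3 * c)) := by ring
      _ ≤ t * (1 - ‖z + v‖ ^ 2) := by gcongr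

lemma incl2 {n : ℕ} {δ : ℝ} (hδ : 0 < δ) (hδ1 : δ ≤ 1) {z w : En n} (hz : z ∈ uball n)
    (hw : w ∈ Dd δ z) :
    ‖herm (w - z) z‖ ≤ 3 / δ * (1 - ‖z‖ ^ 2) ∧ ‖w - z‖ ^ 2 ≤ 4 / δ * (1 - ‖z‖ ^ 2) := by
  have ht := t_pos hz
  have b := Rd_bound hδ hz hw.1 hw.2
  have c := norm_sub_herm hz hw.1
  constructor
  · have e : herm (w - z) z = ((1 - ‖z‖ ^ 2 : ℝ) : ℂ) - (1 - herm w z) := by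
      have := herm_self z
      simp only [herm_eq, inner_sub_right] at *
      rw [this]; push_cast; ring
    rw [e]
    have := norm_sub_le ((1 - ‖z‖ ^ 2 : ℝ) : ℂ) (1 - herm w z)
    rw [Complex.norm_real, Real.norm_of_nonneg ht.le] at this
    have h1 : 1 - ‖z‖ ^ 2 ≤ 1 / δ * (1 - ‖z‖ ^ 2) := by
      rw [div_mul_eq_mul_div, le_div_iff₀ hδ]; nlinarith
    have h3 : 3 / δ * (1 - ‖z‖ ^ 2) = 1 / δ * (1 - ‖z‖ ^ 2) + 2 / δ * (1 - ‖z‖ ^ 2) := by ring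
    linarith
  · have h3 : 4 / δ * (1 - ‖z‖ ^ 2) = 2 * (2 / δ * (1 - ‖z‖ ^ 2)) := by ring
    linarith

lemma uball_open (n : ℕ) : IsOpen (uball n) := Metric.isOpen_ball

lemma cont_herm (n : ℕ) : Continuous fun x : En n × En n => herm x.1 x.2 := by
  simp only [herm_eq]; fun_prop

lemma Dd_open {n : ℕ} (δ : ℝ) :
    IsOpen {x : En n × En n | x.1 ∈ uball n ∧ x.2 ∈ Dd δ x.1} := by
  have h1 : IsOpen {x : En n × En n | x.1 ∈ uball n} := (uball_open n).preimage continuous_fst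
  have h2 : IsOpen {x : En n × En n | x.2 ∈ uball n} := (uball_open n).preimage continuous_snd
  have h3 : IsOpen {x : En n × En n | Rd δ x.1 x.2} := by
    unfold Rd
    have := (cont_herm n).comp (continuous_swap)
    simp only [Function.comp_def, Prod.fst_swap, Prod.snd_swap] at this
    exact isOpen_lt (by fun_prop) (by fun_prop)
  exact h1.inter (h2.inter h3)

lemma Dd_meas {n : ℕ} (δ : ℝ) (z : En n) : MeasurableSet (Dd δ z) := by
  have h3 : IsOpen {w : En n | Rd δ z w} := by
    unfold Rd
    have : Continuous fun w : En n => herm w z :=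
      (cont_herm n).comp (by fun_prop : Continuous fun w : En n => (w, z))
    exact isOpen_lt (by fun_prop) (by fun_prop)
  exact ((uball_open n).inter h3).measurableSet

/-- volume upper bound -/
lemma vol_Dd {n : ℕ} (hn : 1 ≤ n) {δ : ℝ} (hδ : 0 < δ) (hδ1 : δ ≤ 1) :
    ∃ C : ℝ≥0∞, C ≠ ⊤ ∧ ∀ z ∈ uball n,
      vol n (Dd δ z) ≤ C * ENNReal.ofReal ((1 - ‖z‖ ^ 2) ^ (n + 1)) := by
  refine ⟨vol n (Metric.ball 0 (5 / δ)), measure_ball_lt_top.ne, fun z hz => ?_⟩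
  obtain ⟨T, hTb, hTd, -, -, hT3⟩ := exists_T hn z hz
  have ht := t_pos hz
  have hsub : Dd δ z ⊆ (fun u => z + T u) '' Metric.ball 0 (5 / δ) := by
    intro w hw
    obtain ⟨u, hu⟩ := hTb.2 (w - z)
    refine ⟨u, ?_, by simp [hu]⟩
    obtain ⟨i1, i2⟩ := incl2 hδ hδ1 hz hw
    have h3 := hT3 u
    rw [hu] at h3
    set t := 1 - ‖z‖ ^ 2 with htd
    have i3 : ‖herm (w - z) z‖ ^ 2 ≤ (3 / δ * t) ^ 2 := pow_le_pow_left₀ (norm_nonneg _) i1 2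
    have i4 : 2 * t * ‖w - z‖ ^ 2 ≤ 2 * t * (4 / δ * t) := by gcongr
    have i5 : ‖u‖ ^ 2 * t ^ 2 ≤ (9 / δ ^ 2 + 8 / δ) * t ^ 2 := by
      refine (h3.trans (add_le_add i3 i4)).trans_eq ?_
      ring
    have i6 := le_of_mul_le_mul_right i5 (by positivity)
    have i7 : 8 / δ ≤ 8 / δ ^ 2 := by
      apply div_le_div_of_nonneg_left (by norm_num) (by positivity)
      nlinarith
    rw [mem_ball_zero_iff]
    have i8 : ‖u‖ ^ 2 < (5 / δ) ^ 2 := by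
      have : (5 / δ) ^ 2 = 9 / δ ^ 2 + 8 / δ ^ 2 + 8 / δ ^ 2 := by ring
      have : 0 < 8 / δ ^ 2 := by positivity
      linarith
    exact lt_of_pow_lt_pow_left₀ 2 (by positivity) i8
  refine (measure_mono hsub).trans ?_
  have := cov n T hTb.1 z (Metric.ball 0 (5 / δ)) measurableSet_ball (fun _ => 1)
  simp only [lintegral_one, Measure.restrict_apply MeasurableSet.univ, Set.univ_inter] at this
  rw [this, hTd, mul_comm]

/-- submean value property wrt volume -/
lemma submean_vol {n : ℕ} (hn : 1 ≤ n) {δ p : ℝ} (hδ : 0 < δ) (hδ1 : δ < 1) (hp : 0 < p) :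
    ∃ C : ℝ≥0∞, C ≠ ⊤ ∧ ∀ f : En n → ℂ, DifferentiableOn ℂ f (uball n) → ∀ z ∈ uball n,
      ENNReal.ofReal (‖f z‖ ^ p) * ENNReal.ofReal ((1 - ‖z‖ ^ 2) ^ (n + 1)) ≤
        C * ∫⁻ w in Dd δ z, ENNReal.ofReal (‖f w‖ ^ p) ∂vol n := by
  obtain ⟨c, hc, hc1, hcd⟩ : ∃ c : ℝ, 0 < c ∧ c ≤ 1 ∧ δ * (1 + c) ^ 2 < 1 - 3 * c := by
    refine ⟨(1 - δ) / 8, by linarith, by linarith, ?_⟩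
    have h : 0 < 1 - δ := by linarith
    nlinarith [mul_pos h hδ, mul_pos (mul_pos h hδ) h]
  have hv0 : vol n (Metric.ball 0 c) ≠ 0 := (Metric.measure_ball_pos _ _ hc).ne'
  have hvt : vol n (Metric.ball 0 c) ≠ ⊤ := measure_ball_lt_top.ne
  refine ⟨(vol n (Metric.ball 0 c))⁻¹, ENNReal.inv_ne_top.2 hv0, fun f hf z hz => ?_⟩
  obtain ⟨T, hTb, hTd, hT1, hT2, -⟩ := exists_T hn z hz
  have ht := t_pos hz
  have hsub : ∀ u ∈ Metric.ball (0 : En n) c, z + T u ∈ Dd δ z := by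
    intro u hu
    rw [mem_ball_zero_iff] at hu
    refine incl1 hδ hc hc1 hcd hz ((hT1 u).trans ?_) ((hT2 u).trans ?_)
    · gcongr
    · gcongr
  have hd : DifferentiableOn ℂ (fun u => f (z + T u)) (Metric.ball 0 c) :=
    hf.comp (by fun_prop) (fun u hu => (hsub u hu).1)
  have h1 := submean_ball n p c hp _ hd
  have h2 := cov n T hTb.1 z (Metric.ball 0 c) measurableSet_ball (fun w => ENNReal.ofReal (‖f w‖ ^ p))
  simp only [map_zero, add_zero] at h1
  rw [hTd] at h2
  have h3 : ∫⁻ x in (fun u => z + T u) '' Metric.ball 0 c, ENNReal.ofReal (‖f x‖ ^ p) ∂vol n ≤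
      ∫⁻ w in Dd δ z, ENNReal.ofReal (‖f w‖ ^ p) ∂vol n :=
    lintegral_mono_set (by rintro _ ⟨u, hu, rfl⟩; exact hsub u hu)
  rw [h2] at h3
  calc ENNReal.ofReal (‖f z‖ ^ p) * ENNReal.ofReal ((1 - ‖z‖ ^ 2) ^ (n + 1)) 
      = (vol n (Metric.ball 0 c))⁻¹ * (ENNReal.ofReal ((1 - ‖z‖ ^ 2) ^ (n + 1)) *
        (vol n (Metric.ball 0 c) * ENNReal.ofReal (‖f z‖ ^ p))) := by
        rw [mul_left_comm, ← mul_assoc (vol n _)⁻¹, ENNReal.inv_mul_cancel hv0 hvt, one_mul, mul_comm]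
    _ ≤ (vol n (Metric.ball 0 c))⁻¹ * (ENNReal.ofReal ((1 - ‖z‖ ^ 2) ^ (n + 1)) *
        ∫⁻ u in Metric.ball 0 c, ENNReal.ofReal (‖f (z + T u)‖ ^ p) ∂vol n) := by gcongr
    _ ≤ _ := by gcongr

def mu (n : ℕ) (s : ℝ) : Measure (En n) :=
  ((vol n).restrict (uball n)).withDensity (fun z => ENNReal.ofReal ((1 - ‖z‖ ^ 2) ^ s))

instance (n : ℕ) (s : ℝ) : SFinite (mu n s) := by unfold mu; infer_instance

lemma dens_meas (n : ℕ) (s : ℝ) :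
    Measurable (fun z : En n => ENNReal.ofReal ((1 - ‖z‖ ^ 2) ^ s)) := by
  fun_prop

lemma mu_ae (n : ℕ) (s : ℝ) : ∀ᵐ z ∂mu n s, z ∈ uball n := by
  apply (withDensity_absolutelyContinuous _ _).ae_le
  exact ae_restrict_mem (uball_open n).measurableSet

lemma mu_lint (n : ℕ) (s : ℝ) (F : En n → ℝ≥0∞) :
    ∫⁻ w, F w ∂mu n s =
      ∫⁻ w in uball n, ENNReal.ofReal ((1 - ‖w‖ ^ 2) ^ s) * F w ∂vol n := by
  unfold mu
  rw [lintegral_withDensity_eq_lintegral_mul_non_measurable _ (dens_meas n s)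
    (Eventually.of_forall fun x => ENNReal.ofReal_lt_top)]
  rfl

lemma mu_setLint {n : ℕ} (s : ℝ) (δ : ℝ) (z : En n) (F : En n → ℝ≥0∞) :
    ∫⁻ w in Dd δ z, F w ∂mu n s =
      ∫⁻ w in Dd δ z, ENNReal.ofReal ((1 - ‖w‖ ^ 2) ^ s) * F w ∂vol n := by
  unfold mu
  rw [setLIntegral_withDensity_eq_setLIntegral_mul_non_measurable _ (dens_meas n s) _ (Dd_meas δ z)
    (Eventually.of_forall fun x => ENNReal.ofReal_lt_top), Measure.restrict_restrict (Dd_meas δ z),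
    Set.inter_eq_left.2 (fun w hw => hw.1)]
  rfl

lemma rpow_cmp {x y k r : ℝ} (hx : 0 < x) (hy : 0 < y) (hk : 0 < k) (h1 : y ≤ k * x)
    (h2 : x ≤ k * y) : y ^ r ≤ k ^ |r| * x ^ r := by
  rcases le_total 0 r with hr | hr
  · rw [abs_of_nonneg hr, ← Real.mul_rpow hk.le hx.le]
    exact Real.rpow_le_rpow hy.le h1 hr
  · rw [abs_of_nonpos hr]
    have : (k * y) ^ r ≤ x ^ r := Real.rpow_le_rpow_of_nonpos hx h2 hr
    rw [Real.mul_rpow hk.le hy.le] at this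
    calc y ^ r = k ^ (-r) * (k ^ r * y ^ r) := by
          rw [← mul_assoc, ← Real.rpow_add hk]; simp
      _ ≤ _ := by gcongr

lemma mu_cmp {n : ℕ} {δ : ℝ} (hδ : 0 < δ) (s s' : ℝ) :
    ∃ K : ℝ≥0∞, K ≠ ⊤ ∧ ∀ z ∈ uball n, ∀ F : En n → ℝ≥0∞,
      ∫⁻ w in Dd δ z, F w ∂mu n s ≤
        K * ENNReal.ofReal ((1 - ‖z‖ ^ 2) ^ (s - s')) * ∫⁻ w in Dd δ z, F w ∂mu n s' := by
  refine ⟨ENNReal.ofReal ((4 / δ) ^ |s - s'|), ENNReal.ofReal_ne_top, fun z hz F => ?_⟩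
  rw [mu_setLint, mu_setLint, ← lintegral_const_mul' _ _ (by finiteness)]
  refine setLIntegral_mono' (Dd_meas δ z) fun w hw => ?_
  rw [← mul_assoc]
  gcongr
  have hz' := t_pos hz
  have hw' := t_pos hw.1
  have h1 := Rd_comp hδ hz hw.1 hw.2
  have h2 := Rd_comp hδ hw.1 hz (Rd_symm hw.2)
  rw [← ENNReal.ofReal_mul (by positivity), ← ENNReal.ofReal_mul (by positivity)]
  apply ENNReal.ofReal_le_ofReal
  have h3 : (1 - ‖w‖ ^ 2) ^ (s - s') ≤ (4 / δ) ^ |s - s'| * (1 - ‖z‖ ^ 2) ^ (s - s') := by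
    apply rpow_cmp hz' hw' (by positivity)
    · rw [div_mul_eq_mul_div, le_div_iff₀ hδ]; linarith
    · rw [div_mul_eq_mul_div, le_div_iff₀ hδ]; linarith
  calc (1 - ‖w‖ ^ 2) ^ s = (1 - ‖w‖ ^ 2) ^ (s - s') * (1 - ‖w‖ ^ 2) ^ s' := by
        rw [← Real.rpow_add hw']; ring_nf
    _ ≤ _ := by gcongr

lemma mu_zero {n : ℕ} (δ : ℝ) (z : En n) (F : En n → ℝ≥0∞) :
    ∫⁻ w in Dd δ z, F w ∂mu n 0 = ∫⁻ w in Dd δ z, F w ∂vol n := by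
  rw [mu_setLint]; simp

lemma mu_Dd {n : ℕ} (hn : 1 ≤ n) {δ : ℝ} (hδ : 0 < δ) (hδ1 : δ ≤ 1) (s : ℝ) :
    ∃ C : ℝ≥0∞, C ≠ ⊤ ∧ ∀ z ∈ uball n,
      mu n s (Dd δ z) ≤ C * ENNReal.ofReal ((1 - ‖z‖ ^ 2) ^ ((n : ℝ) + 1 + s)) := by
  obtain ⟨C, hC, h⟩ := vol_Dd hn hδ hδ1
  obtain ⟨K, hK, h'⟩ := mu_cmp (n := n) hδ s 0
  refine ⟨K * C, by finiteness, fun z hz => ?_⟩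
  have h1 := h' z hz (fun _ => 1)
  rw [mu_zero] at h1
  simp only [lintegral_one, Measure.restrict_apply MeasurableSet.univ, Set.univ_inter,
    sub_zero] at h1
  refine h1.trans ?_
  have ht := t_pos hz
  calc K * ENNReal.ofReal ((1 - ‖z‖ ^ 2) ^ s) * vol n (Dd δ z) ≤
      K * ENNReal.ofReal ((1 - ‖z‖ ^ 2) ^ s) * (C * ENNReal.ofReal ((1 - ‖z‖ ^ 2) ^ (n + 1))) := by
        gcongr; exact h z hz
    _ = K * C * (ENNReal.ofReal ((1 - ‖z‖ ^ 2) ^ (n + 1)) * ENNReal.ofReal ((1 - ‖z‖ ^ 2) ^ s)) := by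
        ring
    _ = _ := by
        rw [← ENNReal.ofReal_mul (by positivity), Real.rpow_add ht ((n : ℝ) + 1),
          ← Real.rpow_natCast _ (n + 1)]
        push_cast; rfl

lemma submean_mu {n : ℕ} (hn : 1 ≤ n) {δ p : ℝ} (hδ : 0 < δ) (hδ1 : δ < 1) (hp : 0 < p) (s : ℝ) :
    ∃ C : ℝ≥0∞, C ≠ ⊤ ∧ ∀ f : En n → ℂ, DifferentiableOn ℂ f (uball n) → ∀ z ∈ uball n,
      ENNReal.ofReal (‖f z‖ ^ p) * ENNReal.ofReal ((1 - ‖z‖ ^ 2) ^ ((n : ℝ) + 1 + s)) ≤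
        C * ∫⁻ w in Dd δ z, ENNReal.ofReal (‖f w‖ ^ p) ∂mu n s := by
  obtain ⟨C, hC, h⟩ := submean_vol hn hδ hδ1 hp
  obtain ⟨K, hK, h'⟩ := mu_cmp (n := n) hδ 0 s
  refine ⟨C * K, by finiteness, fun f hf z hz => ?_⟩
  have h1 := h f hf z hz
  have h2 := h' z hz (fun w => ENNReal.ofReal (‖f w‖ ^ p))
  rw [mu_zero] at h2
  have ht := t_pos hz
  have e : ENNReal.ofReal ((1 - ‖z‖ ^ 2) ^ ((n : ℝ) + 1 + s)) =
      ENNReal.ofReal ((1 - ‖z‖ ^ 2) ^ (n + 1)) * ENNReal.ofReal ((1 - ‖z‖ ^ 2) ^ s) := by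
    rw [← ENNReal.ofReal_mul (by positivity), Real.rpow_add ht ((n : ℝ) + 1),
          ← Real.rpow_natCast _ (n + 1)]
    push_cast; rfl
  have e2 : ENNReal.ofReal ((1 - ‖z‖ ^ 2) ^ (0 - s)) * ENNReal.ofReal ((1 - ‖z‖ ^ 2) ^ s) = 1 := by
    rw [← ENNReal.ofReal_mul (by positivity), ← Real.rpow_add ht]; simp
  rw [e, ← mul_assoc]
  calc _ ≤ (C * ∫⁻ w in Dd δ z, ENNReal.ofReal (‖f w‖ ^ p) ∂vol n) *
        ENNReal.ofReal ((1 - ‖z‖ ^ 2) ^ s) := by gcongr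
    _ ≤ (C * (K * ENNReal.ofReal ((1 - ‖z‖ ^ 2) ^ (0 - s)) *
        ∫⁻ w in Dd δ z, ENNReal.ofReal (‖f w‖ ^ p) ∂mu n s)) *
        ENNReal.ofReal ((1 - ‖z‖ ^ 2) ^ s) := by gcongr
    _ = (C * K * (∫⁻ w in Dd δ z, ENNReal.ofReal (‖f w‖ ^ p) ∂mu n s)) *
        (ENNReal.ofReal ((1 - ‖z‖ ^ 2) ^ (0 - s)) * ENNReal.ofReal ((1 - ‖z‖ ^ 2) ^ s)) := by ring
    _ = _ := by rw [e2, mul_one]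

lemma submean_tau {n : ℕ} (hn : 1 ≤ n) {δ p : ℝ} (hδ : 0 < δ) (hδ1 : δ < 1) (hp : 0 < p) :
    ∃ C : ℝ≥0∞, C ≠ ⊤ ∧ ∀ f : En n → ℂ, DifferentiableOn ℂ f (uball n) → ∀ z ∈ uball n,
      ENNReal.ofReal (‖f z‖ ^ p) ≤
        C * ∫⁻ w in Dd δ z, ENNReal.ofReal (‖f w‖ ^ p) ∂measTau n := by
  obtain ⟨C, hC, h⟩ := submean_mu hn hδ hδ1 hp (-((n : ℝ) + 1))
  refine ⟨C, hC, fun f hf z hz => ?_⟩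
  have := h f hf z hz
  rw [add_neg_cancel, Real.rpow_zero, ENNReal.ofReal_one, mul_one] at this
  exact this

lemma cnorm_pos (n : ℕ) {α : ℝ} (hα : -1 < α) : 0 < cnorm n α := by
  unfold cnorm
  rw [if_pos hα]
  have h1 : 0 < Real.Gamma (n + α + 1) :=
    Real.Gamma_pos_of_pos (by have : (0:ℝ) ≤ n := Nat.cast_nonneg n; linarith)
  have h2 : 0 < Real.Gamma (α + 1) := Real.Gamma_pos_of_pos (by linarith)
  positivity

lemma measA_eq (n : ℕ) {α : ℝ} (hα : -1 < α) :
    measA n α = ENNReal.ofReal (cnorm n α) • mu n α := by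
  unfold measA mu
  rw [← withDensity_smul _ (dens_meas n α)]
  congr 1
  ext z
  rw [ENNReal.ofReal_mul (cnorm_pos n hα).le]; rfl

lemma measA_ae (n : ℕ) (α : ℝ) : ∀ᵐ z ∂measA n α, z ∈ uball n := by
  apply (withDensity_absolutelyContinuous _ _).ae_le
  exact ae_restrict_mem (uball_open n).measurableSet

/-- Fubini step -/
lemma fub {n : ℕ} (hn : 1 ≤ n) {δ p α : ℝ} (hδ : 0 < δ) (hδ1 : δ ≤ 1) (hp : 0 < p) 
    (hα : -1 < α) :
    ∃ C : ℝ≥0∞, C ≠ ⊤ ∧ ∀ f : En n → ℂ, DifferentiableOn ℂ f (uball n) →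
      ∫⁻ z, (∫⁻ w in Dd δ z, ENNReal.ofReal (‖f w‖ ^ p) ∂measTau n) ∂measA n α ≤
        C * ∫⁻ z, ENNReal.ofReal (‖f z‖ ^ p) ∂measA n α := by
  obtain ⟨C, hC, h⟩ := mu_Dd hn hδ hδ1 α
  refine ⟨C, hC, fun f hf => ?_⟩
  rw [measA_eq n hα, lintegral_smul_measure, lintegral_smul_measure, smul_eq_mul, smul_eq_mul,
    mul_left_comm]
  gcongr
  set G : En n → ℝ≥0∞ := (uball n).indicator (fun u => ENNReal.ofReal (‖f u‖ ^ p)) with hG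
  have hGm : Measurable G := meas_ind n p hp _ (uball_open n) f hf
  set U : Set (En n × En n) := {x | x.1 ∈ uball n ∧ x.2 ∈ Dd δ x.1} with hU
  have hUm : MeasurableSet U := (Dd_open δ).measurableSet
  set H : En n × En n → ℝ≥0∞ := U.indicator (fun x => G x.2) with hH
  have hHm : Measurable H := (hGm.comp measurable_snd).indicator hUm
  have htau : measTau n = mu n (-((n : ℝ) + 1)) := rfl
  rw [htau]
  calc ∫⁻ z, (∫⁻ w in Dd δ z, ENNReal.ofReal (‖f w‖ ^ p) ∂mu n (-((n : ℝ) + 1))) ∂mu n α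
      = ∫⁻ z, (∫⁻ w, H (z, w) ∂mu n (-((n : ℝ) + 1))) ∂mu n α := by
        refine lintegral_congr_ae ?_
        filter_upwards [mu_ae n α] with z hz
        rw [← lintegral_indicator (Dd_meas δ z)]
        congr 1
        ext w
        by_cases hw : w ∈ Dd δ z
        · have : (z, w) ∈ U := ⟨hz, hw⟩
          rw [Set.indicator_of_mem hw, hH, Set.indicator_of_mem this, hG,
            Set.indicator_of_mem hw.1]
        · have : (z, w) ∉ U := fun h => hw h.2
          rw [Set.indicator_of_notMem hw, hH, Set.indicator_of_notMem this]
    _ = ∫⁻ w, (∫⁻ z, H (z, w) ∂mu n α) ∂mu n (-((n : ℝ) + 1)) :=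
        lintegral_lintegral_swap hHm.aemeasurable
    _ ≤ ∫⁻ w, C * (ENNReal.ofReal ((1 - ‖w‖ ^ 2) ^ ((n : ℝ) + 1 + α)) *
          ENNReal.ofReal (‖f w‖ ^ p)) ∂mu n (-((n : ℝ) + 1)) := by
        refine lintegral_mono_ae ?_
        filter_upwards [mu_ae n (-((n : ℝ) + 1))] with w hw
        calc ∫⁻ z, H (z, w) ∂mu n α ≤ ∫⁻ z, (Dd δ w).indicator 
              (fun _ => ENNReal.ofReal (‖f w‖ ^ p)) z ∂mu n α := by
              refine lintegral_mono fun z => ?_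
              by_cases hzw : (z, w) ∈ U
              · have : z ∈ Dd δ w := ⟨hzw.1, Rd_symm hzw.2.2⟩
                rw [Set.indicator_of_mem this, hH, Set.indicator_of_mem hzw, hG,
                  Set.indicator_of_mem hw]
              · rw [hH, Set.indicator_of_notMem hzw]; exact zero_le
          _ = ENNReal.ofReal (‖f w‖ ^ p) * mu n α (Dd δ w) := by
              rw [lintegral_indicator (Dd_meas δ w), setLIntegral_const]
          _ ≤ ENNReal.ofReal (‖f w‖ ^ p) * (C * _) := by gcongr; exact h w hw
          _ = _ := by ring
    _ = C * ∫⁻ z, ENNReal.ofReal (‖f z‖ ^ p) ∂mu n α := by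
        rw [lintegral_const_mul' _ _ hC, mu_lint, mu_lint]
        congr 1
        refine setLIntegral_congr_fun (uball_open n).measurableSet fun w hw => ?_
        have ht := t_pos hw
        rw [← mul_assoc, ← ENNReal.ofReal_mul (by positivity), ← Real.rpow_add ht]
        congr 3; ring

lemma pw1 {n : ℕ} (hn : 1 ≤ n) {δ γ p q : ℝ} (hδ : 0 < δ) (hδ1 : δ < 1) (hp : 0 < p) (hq : 0 < q)
    (hD : ∀ z : En n, z ∈ uball n → Dball z γ = Dd δ z) :
    ∃ C : ℝ≥0∞, C ≠ ⊤ ∧ ∀ f : En n → ℂ, DifferentiableOn ℂ f (uball n) → ∀ z ∈ uball n,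
      ENNReal.ofReal (‖f z‖ ^ p) ≤ C * (areaF γ q (fun w => ‖f w‖) z) ^ p := by
  obtain ⟨C, hC, h⟩ := submean_tau hn hδ hδ1 hq
  refine ⟨C ^ (p / q), by finiteness, fun f hf z hz => ?_⟩
  have h1 := ENNReal.rpow_le_rpow (h f hf z hz) (div_pos hp hq).le
  rw [ENNReal.ofReal_rpow_of_nonneg (by positivity) (by positivity), ← Real.rpow_mul (norm_nonneg _),
    mul_div_cancel₀ p hq.ne', ENNReal.mul_rpow_of_nonneg _ _ (by positivity)] at h1
  refine h1.trans (le_of_eq ?_)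
  unfold areaF
  rw [hD z hz, ← ENNReal.rpow_mul, one_div, inv_mul_eq_div]
  simp_rw [ENNReal.ofReal_rpow_of_nonneg (norm_nonneg _) hq.le]

lemma avg_eq {n : ℕ} {α : ℝ} (hα : -1 < α) (D : Set (En n)) (F : En n → ℝ≥0∞) :
    (measA n α D)⁻¹ * ∫⁻ u in D, F u ∂measA n α = (mu n α D)⁻¹ * ∫⁻ u in D, F u ∂mu n α := by
  have h0 : ENNReal.ofReal (cnorm n α) ≠ 0 := by simpa using cnorm_pos n hα
  have h1 : ENNReal.ofReal (cnorm n α) ≠ ⊤ := ENNReal.ofReal_ne_top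
  rw [measA_eq n hα, Measure.restrict_smul, lintegral_smul_measure, Measure.smul_apply, smul_eq_mul,
    smul_eq_mul, ENNReal.mul_inv (Or.inl h0) (Or.inl h1)]
  rw [mul_mul_mul_comm, ENNReal.inv_mul_cancel h0 h1, one_mul]

lemma pw2 {n : ℕ} (hn : 1 ≤ n) {δ γ p q α : ℝ} (hδ : 0 < δ) (hδ1 : δ < 1) (hp : 0 < p) (hq : 0 < q)
    (hα : -1 < α)
    (hD : ∀ z : En n, z ∈ uball n → Dball z γ = Dd δ z) :
    ∃ C : ℝ≥0∞, C ≠ ⊤ ∧ ∀ f : En n → ℂ, DifferentiableOn ℂ f (uball n) → ∀ z ∈ uball n,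
      ENNReal.ofReal (‖f z‖ ^ p) ≤ C * (maxHL γ q α (fun w => ‖f w‖) z) ^ p := by
  obtain ⟨C, hC, h⟩ := submean_mu hn hδ hδ1 hq α
  obtain ⟨C', hC', h'⟩ := mu_Dd hn hδ hδ1.le α
  refine ⟨(C * (C' + 1)) ^ (p / q), by finiteness, fun f hf z hz => ?_⟩
  have h1 := h f hf z hz
  have h2 := h' z hz
  have ht := t_pos hz
  set T := ENNReal.ofReal ((1 - ‖z‖ ^ 2) ^ ((n : ℝ) + 1 + α)) with hT
  have hT0 : T ≠ 0 := by
    rw [hT]; simpa using Real.rpow_pos_of_pos ht _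
  have hTt : T ≠ ⊤ := ENNReal.ofReal_ne_top
  set I := ∫⁻ w in Dd δ z, ENNReal.ofReal (‖f w‖ ^ q) ∂mu n α with hI
  have h3 : T⁻¹ ≤ (C' + 1) * (mu n α (Dd δ z))⁻¹ := by
    have a : mu n α (Dd δ z) ≤ (C' + 1) * T := h2.trans (by gcongr; exact le_self_add)
    have b := ENNReal.inv_le_inv.2 a
    have c0 : C' + 1 ≠ 0 := by simp
    have ct : C' + 1 ≠ ⊤ := by finiteness
    rw [ENNReal.mul_inv (Or.inl c0) (Or.inl ct)] at b
    calc T⁻¹ = (C' + 1) * ((C' + 1)⁻¹ * T⁻¹) := by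
          rw [← mul_assoc, ENNReal.mul_inv_cancel c0 ct, one_mul]
      _ ≤ _ := by gcongr
  have h4 : ENNReal.ofReal (‖f z‖ ^ q) ≤ C * (C' + 1) * ((mu n α (Dd δ z))⁻¹ * I) := by
    calc ENNReal.ofReal (‖f z‖ ^ q) = ENNReal.ofReal (‖f z‖ ^ q) * T * T⁻¹ := by
          rw [mul_assoc, ENNReal.mul_inv_cancel hT0 hTt, mul_one]
      _ ≤ C * I * ((C' + 1) * (mu n α (Dd δ z))⁻¹) := by gcongr
      _ = _ := by ring
  have h5 := ENNReal.rpow_le_rpow h4 (div_pos hp hq).le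
  rw [ENNReal.ofReal_rpow_of_nonneg (by positivity) (by positivity), ← Real.rpow_mul (norm_nonneg _),
    mul_div_cancel₀ p hq.ne', ENNReal.mul_rpow_of_nonneg _ _ (by positivity)] at h5
  refine h5.trans ?_
  gcongr
  have h6 : ((mu n α (Dd δ z))⁻¹ * I) ^ (1 / q) ≤ maxHL γ q α (fun w => ‖f w‖) z := by
    unfold maxHL
    have hm : z ∈ {w : En n | w ∈ uball n ∧ z ∈ Dball w γ} := by
      refine ⟨hz, ?_⟩
      rw [hD z hz]
      exact ⟨hz, Rd_self hδ1 hz⟩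
    refine le_trans (le_of_eq ?_) (le_iSup₂_of_le z hm le_rfl)
    rw [avg_eq hα, hD z hz]
    simp_rw [ENNReal.ofReal_rpow_of_nonneg (norm_nonneg _) hq.le]
    rfl
  calc _ = (((mu n α (Dd δ z))⁻¹ * I) ^ (1 / q)) ^ p := by
        rw [← ENNReal.rpow_mul, one_div, inv_mul_eq_div]
    _ ≤ _ := ENNReal.rpow_le_rpow h6 hp.le

lemma pw3 {n : ℕ} (hn : 1 ≤ n) {δ γ p q α : ℝ} (hδ : 0 < δ) (hδ1 : δ < 1) (hp : 0 < p) (hq : 0 < q)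
    (hα : -1 < α)
    (hD : ∀ z : En n, z ∈ uball n → Dball z γ = Dd δ z) :
    ∃ C : ℝ≥0∞, ∃ δ' : ℝ, C ≠ ⊤ ∧ 0 < δ' ∧ δ' ≤ 1 ∧
      ∀ f : En n → ℂ, DifferentiableOn ℂ f (uball n) → ∀ z ∈ uball n,
      (areaF γ q (fun w => ‖f w‖) z) ^ p ≤
        C * ∫⁻ w in Dd δ' z, ENNReal.ofReal (‖f w‖ ^ p) ∂measTau n ∧
      (maxHL γ q α (fun w => ‖f w‖) z) ^ p ≤
        C * ∫⁻ w in Dd δ' z, ENNReal.ofReal (‖f w‖ ^ p) ∂measTau n := by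
  obtain ⟨C, hC, h⟩ := submean_tau hn hδ hδ1 hp
  obtain ⟨K, hK, h'⟩ := mu_Dd hn hδ hδ1.le (-((n : ℝ) + 1))
  set δ1 := δ ^ 4 / 1400 with e1
  have p1 : 0 < δ1 := by positivity
  have l1 : δ1 ≤ δ := by
    have : δ ^ 4 ≤ δ := pow_le_of_le_one hδ.le hδ1.le (by norm_num)
    rw [e1]; linarith
  set δ2 := δ1 ^ 4 / 1400 with e2
  have p2 : 0 < δ2 := by positivity
  have l2 : δ2 ≤ δ1 := by
    have : δ1 ^ 4 ≤ δ1 := pow_le_of_le_one p1.le (by linarith) (by norm_num)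
    rw [e2]; linarith
  refine ⟨(K ^ (p / q) + 1) * C, δ2, by finiteness, p2, by linarith, fun f hf z hz => ?_⟩
  set S := ∫⁻ w in Dd δ2 z, ENNReal.ofReal (‖f w‖ ^ p) ∂measTau n with hS
  have key : ∀ u ∈ Dd δ1 z, ENNReal.ofReal ‖f u‖ ^ q ≤ (C * S) ^ (q / p) := by
    intro u hu
    have h1 := h f hf u hu.1
    have hsub : Dd δ u ⊆ Dd δ2 z := fun v hv =>
      ⟨hv.1, Rd_trans p1 (by linarith) hz hu.1 hv.1 hu.2 (Rd_mono l1 hv.2)⟩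
    have h2 : ENNReal.ofReal (‖f u‖ ^ p) ≤ C * S := h1.trans (by
      gcongr
      exact lintegral_mono_set hsub)
    have h3 := ENNReal.rpow_le_rpow h2 (div_pos hq hp).le
    rw [← ENNReal.ofReal_rpow_of_nonneg (norm_nonneg _) hp.le, ← ENNReal.rpow_mul,
      mul_div_cancel₀ q hp.ne'] at h3
    exact h3
  constructor
  · unfold areaF
    rw [hD z hz, ← ENNReal.rpow_mul, one_div, inv_mul_eq_div]
    have h4 : ∫⁻ w in Dd δ z, ENNReal.ofReal ‖f w‖ ^ q ∂measTau n ≤ (C * S) ^ (q / p) * K := by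
      calc _ ≤ ∫⁻ w in Dd δ z, (C * S) ^ (q / p) ∂measTau n :=
            setLIntegral_mono' (Dd_meas δ z) fun w hw => key w ⟨hw.1, Rd_mono l1 hw.2⟩
        _ = (C * S) ^ (q / p) * measTau n (Dd δ z) := setLIntegral_const _ _
        _ ≤ _ := by
          gcongr
          have := h' z hz
          rw [add_neg_cancel, Real.rpow_zero, ENNReal.ofReal_one, mul_one] at this
          exact this
    calc _ ≤ ((C * S) ^ (q / p) * K) ^ (p / q) := ENNReal.rpow_le_rpow h4 (by positivity)
      _ = K ^ (p / q) * C * S := by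
        rw [ENNReal.mul_rpow_of_nonneg _ _ (by positivity), ← ENNReal.rpow_mul,
          show q / p * (p / q) = 1 by field_simp, ENNReal.rpow_one]; ring
      _ ≤ _ := by gcongr; exact le_self_add
  · have h4 : maxHL γ q α (fun w => ‖f w‖) z ≤ (C * S) ^ (1 / p) := by
      unfold maxHL
      refine iSup₂_le fun w hw => ?_
      obtain ⟨hw1, hw2⟩ := hw
      rw [hD w hw1] at hw2 ⊢
      have h5 : ∫⁻ u in Dd δ w, ENNReal.ofReal ‖f u‖ ^ q ∂measA n α ≤
          (C * S) ^ (q / p) * measA n α (Dd δ w) := by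
        rw [← setLIntegral_const]
        exact setLIntegral_mono' (Dd_meas δ w) fun u hu =>
          key u ⟨hu.1, Rd_trans hδ hδ1.le hz hw1 hu.1 (Rd_symm hw2.2) hu.2⟩
      calc _ ≤ ((C * S) ^ (q / p)) ^ (1 / q) := by
            apply ENNReal.rpow_le_rpow _ (by positivity)
            calc _ ≤ (measA n α (Dd δ w))⁻¹ * ((C * S) ^ (q / p) * measA n α (Dd δ w)) := by
                  gcongr
              _ = (C * S) ^ (q / p) * ((measA n α (Dd δ w))⁻¹ * measA n α (Dd δ w)) := by ring
              _ ≤ (C * S) ^ (q / p) * 1 := by gcongr; exact ENNReal.inv_mul_le_one _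
              _ = _ := mul_one _
        _ = _ := by
          rw [← ENNReal.rpow_mul, show q / p * (1 / q) = 1 / p by field_simp]
    calc _ ≤ ((C * S) ^ (1 / p)) ^ p := ENNReal.rpow_le_rpow h4 hp.le
      _ = 1 * C * S := by
        rw [← ENNReal.rpow_mul, one_div_mul_cancel hp.ne', ENNReal.rpow_one, one_mul]
      _ ≤ _ := by gcongr; exact le_add_self

lemma fin_lt {K X Y : ℝ≥0∞} (hK : K ≠ ⊤) (h1 : X ≤ K * Y) (h2 : Y ≤ K * X) : X < ⊤ ↔ Y < ⊤ :=
  ⟨fun h => h2.trans_lt (ENNReal.mul_lt_top hK.lt_top h),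
    fun h => h1.trans_lt (ENNReal.mul_lt_top hK.lt_top h)⟩

lemma fin_le {K X Y : ℝ≥0∞} {p : ℝ} (hp : 0 < p) (hK0 : K ≠ 0) (hK : K ≠ ⊤)
    (h1 : X ≤ K * Y) (h2 : Y ≤ K * X) :
    (K ^ (1 / p))⁻¹ * Y ^ (1 / p) ≤ X ^ (1 / p) ∧ X ^ (1 / p) ≤ K ^ (1 / p) * Y ^ (1 / p) := by
  have hp' : 0 ≤ 1 / p := by positivity
  have e1 := ENNReal.rpow_le_rpow h1 hp'
  have e2 := ENNReal.rpow_le_rpow h2 hp'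
  rw [ENNReal.mul_rpow_of_nonneg _ _ hp'] at e1 e2
  refine ⟨?_, e1⟩
  have c0 : K ^ (1 / p) ≠ 0 := by
    simp [ENNReal.rpow_eq_zero_iff, hK0, hK]
  have ct : K ^ (1 / p) ≠ ⊤ := by finiteness
  calc _ ≤ (K ^ (1 / p))⁻¹ * (K ^ (1 / p) * X ^ (1 / p)) := by gcongr
    _ = _ := by rw [← mul_assoc, ENNReal.inv_mul_cancel c0 ct, one_mul]

lemma int_bd {n : ℕ} {α : ℝ} {C : ℝ≥0∞} (hC : C ≠ ⊤) (F G : En n → ℝ≥0∞)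
    (h : ∀ z ∈ uball n, F z ≤ C * G z) :
    ∫⁻ z, F z ∂measA n α ≤ C * ∫⁻ z, G z ∂measA n α := by
  rw [← lintegral_const_mul' _ _ hC]
  apply lintegral_mono_ae
  filter_upwards [measA_ae n α] with z hz using h z hz


/-- Tent space characterization of Bergman spaces:
`f ∈ A^p_α` iff `A_γ^{(q)} f ∈ L^p` iff `M_γ^{(q)} f ∈ L^p`, with pairwise comparable norms. -/
theorem stmt9 (n : ℕ) (hn : 1 ≤ n) (γ q α p : ℝ) (hγ : 0 < γ) (hq : 1 < q) (hα : -1 < α)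
    (hp : 0 < p) :
    ∃ C : ℝ≥0∞, 0 < C ∧ C < ⊤ ∧
      ∀ f : En n → ℂ, DifferentiableOn ℂ f (uball n) →
        ((apnorm n p α f < ⊤ ↔
            (∫⁻ z, (areaF γ q (fun w => ‖f w‖) z) ^ p ∂measA n α) < ⊤) ∧
         (apnorm n p α f < ⊤ ↔
            (∫⁻ z, (maxHL γ q α (fun w => ‖f w‖) z) ^ p ∂measA n α) < ⊤) ∧
         (C⁻¹ * (∫⁻ z, (areaF γ q (fun w => ‖f w‖) z) ^ p ∂measA n α) ^ (1 / p) ≤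
              apnorm n p α f ∧
          apnorm n p α f ≤
              C * (∫⁻ z, (areaF γ q (fun w => ‖f w‖) z) ^ p ∂measA n α) ^ (1 / p)) ∧
         (C⁻¹ * (∫⁻ z, (maxHL γ q α (fun w => ‖f w‖) z) ^ p ∂measA n α) ^ (1 / p) ≤
              apnorm n p α f ∧
          apnorm n p α f ≤
              C * (∫⁻ z, (maxHL γ q α (fun w => ‖f w‖) z) ^ p ∂measA n α) ^ (1 / p)) ∧
         (C⁻¹ * (∫⁻ z, (maxHL γ q α (fun w => ‖f w‖) z) ^ p ∂measA n α) ^ (1 / p) ≤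
              (∫⁻ z, (areaF γ q (fun w => ‖f w‖) z) ^ p ∂measA n α) ^ (1 / p) ∧
          (∫⁻ z, (areaF γ q (fun w => ‖f w‖) z) ^ p ∂measA n α) ^ (1 / p) ≤
              C * (∫⁻ z, (maxHL γ q α (fun w => ‖f w‖) z) ^ p ∂measA n α) ^ (1 / p))) := by
  obtain ⟨δ, hδ, hδ1, hD⟩ := Dball_eq (n := n) hγ
  have hq0 : 0 < q := by linarith
  obtain ⟨C1, hC1, H1⟩ := pw1 hn hδ hδ1 hp hq0 hD
  obtain ⟨C2, hC2, H2⟩ := pw2 hn hδ hδ1 hp hq0 hα hD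
  obtain ⟨C3, δ', hC3, hδ', hδ'1, H3⟩ := pw3 hn hδ hδ1 hp hq0 hα hD
  obtain ⟨C4, hC4, H4⟩ := fub hn hδ' hδ'1 hp hα
  set K : ℝ≥0∞ := 1 + C1 + C2 + C3 * C4 with hK
  have K1 : 1 ≤ K := by rw [hK, add_assoc, add_assoc]; exact le_self_add
  have Kt : K ≠ ⊤ := by finiteness
  have kC1 : C1 ≤ K := by
    rw [hK, add_comm 1 C1, add_assoc, add_assoc]; exact le_self_add
  have kC2 : C2 ≤ K := by
    rw [hK, add_comm (1 + C1) C2, add_assoc]; exact le_self_add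
  have kC3 : C3 * C4 ≤ K := le_add_self
  have KK1 : K ≤ K * K := le_mul_of_one_le_left' K1
  have KK0 : K * K ≠ 0 := (lt_of_lt_of_le one_pos (K1.trans KK1)).ne'
  have KKt : K * K ≠ ⊤ := by finiteness
  refine ⟨(K * K) ^ (1 / p), ENNReal.rpow_pos (pos_iff_ne_zero.2 KK0) KKt, ?_, fun f hf => ?_⟩
  · exact ENNReal.rpow_lt_top_of_nonneg (by positivity) KKt
  have E1 := int_bd (α := α) hC1 _ _ (H1 f hf)
  have E2 := int_bd (α := α) hC2 _ _ (H2 f hf)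
  have E3 := (int_bd (α := α) hC3 _ _ (fun z hz => (H3 f hf z hz).1)).trans
    (mul_le_mul_right (H4 f hf) C3)
  have E4 := (int_bd (α := α) hC3 _ _ (fun z hz => (H3 f hf z hz).2)).trans
    (mul_le_mul_right (H4 f hf) C3)
  rw [← mul_assoc] at E3 E4
  unfold apnorm
  set X := ∫⁻ z, ENNReal.ofReal (‖f z‖ ^ p) ∂measA n α
  set Y := ∫⁻ z, (areaF γ q (fun w => ‖f w‖) z) ^ p ∂measA n α
  set Z := ∫⁻ z, (maxHL γ q α (fun w => ‖f w‖) z) ^ p ∂measA n α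
  have F1 : X ≤ K * Y := E1.trans (by gcongr)
  have F2 : X ≤ K * Z := E2.trans (by gcongr)
  have F3 : Y ≤ K * X := E3.trans (by gcongr)
  have F4 : Z ≤ K * X := E4.trans (by gcongr)
  have G1 : X ≤ K * K * Y := F1.trans (by gcongr)
  have G2 : X ≤ K * K * Z := F2.trans (by gcongr)
  have G3 : Y ≤ K * K * X := F3.trans (by gcongr)
  have G4 : Z ≤ K * K * X := F4.trans (by gcongr)
  have G5 : Y ≤ K * K * Z := F3.trans (by rw [mul_assoc]; gcongr)
  have G6 : Z ≤ K * K * Y := F4.trans (by rw [mul_assoc]; gcongr)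
  have hX : X ^ (1 / p) < ⊤ ↔ X < ⊤ := ENNReal.rpow_lt_top_iff_of_pos (by positivity)
  refine ⟨?_, ?_, fin_le hp KK0 KKt G1 G3, fin_le hp KK0 KKt G2 G4, fin_le hp KK0 KKt G5 G6⟩
  · rw [hX]; exact fin_lt KKt G1 G3
  · rw [hX]; exact fin_lt KKt G2 G4
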